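/- arXiv:1212.2939 — 4 statements merged into one kernel-verified Lean document; each statement's English description precedes it below -/
import Mathlib

section
/- Let 0 < q < 1. Define f₋ : ℤ → ℝ by f₋(m) = q^{−m} for m ≤ 0 and f₋(m) = 0 for m > 0 (the Laurent coefficients of (1−qz^{−1})^{−1}), and f₊ : ℤ → ℝ by f₊(m) = q^m for m ≥ 0 and f₊(m) = 0 for m < 0 (the Taylor coefficients of (1−qz)^{−1}). Then for all λ, μ ∈ 𝒲ₙ: det[f₋((λⱼ−j)−(μᵢ−i))]_{i,j=1}^n equals q^{Σᵢ(μᵢ−λᵢ)} if λ ≺ μ and equals 0 otherwise; and det[f₊((λⱼ−j)−(μᵢ−i))]_{i,j=1}^n equals q^{Σᵢ(λᵢ−μᵢ)} if μ ≺ λ and equals 0 otherwise. -/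
open scoped BigOperators
open scoped Classical

/-- A signature of length `n`: a nonincreasing `n`-tuple of integers. -/
def Sig (n : ℕ) : Type := {f : Fin n → ℤ // ∀ i j : Fin n, i ≤ j → f j ≤ f i}

/-- `Interlace l m` means `l ≺ m`, i.e. `m₁ ≥ l₁ ≥ m₂ ≥ l₂ ≥ … ≥ mₙ ≥ lₙ`. -/
def Interlace {n : ℕ} (l m : Sig n) : Prop :=
  (∀ i, l.1 i ≤ m.1 i) ∧ ∀ i : Fin n, ∀ h : (i : ℕ) + 1 < n, m.1 ⟨(i : ℕ) + 1, h⟩ ≤ l.1 i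

/-- The determinant of the step matrix `1(bⱼ ≤ aᵢ)` of two strictly decreasing sequences detects
interlacing. -/
theorem det_step_matrix (n : ℕ) (a b : Fin n → ℤ) (ha : StrictAnti a) (hb : StrictAnti b) :
    Matrix.det (Matrix.of fun i j : Fin n => if b j ≤ a i then (1 : ℝ) else 0)
      = if (∀ i, b i ≤ a i) ∧ ∀ i : Fin n, ∀ h : (i : ℕ) + 1 < n, a ⟨(i : ℕ) + 1, h⟩ < b i
        then 1 else 0 := by
  induction n with
  | zero =>
    rw [if_pos ⟨fun i => i.elim0, fun i => i.elim0⟩]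
    simp
  | succ n ih =>
    by_cases h0 : b 0 ≤ a 0
    · by_cases h1 : ∃ i : Fin n, b 0 ≤ a i.succ
      · obtain ⟨k, hk⟩ := h1
        rw [if_neg]
        · refine Matrix.det_zero_of_row_eq (Fin.succ_ne_zero k).symm ?_
          ext j
          have hj : b j ≤ b 0 := hb.antitone (Fin.zero_le j)
          simp [hj.trans h0, hj.trans hk]
        · rintro ⟨-, h⟩
          have hn : 0 < n := k.pos
          have h2 := h 0 (by simpa using hn)
          have h3 : a k.succ ≤ a ⟨((0 : Fin (n + 1)) : ℕ) + 1, by simpa using hn⟩ :=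
            ha.antitone (by simp [Fin.le_def])
          omega
      · push Not at h1
        have hs := ih (fun i => a i.succ) (fun i => b i.succ)
          (fun _ _ h => ha (Fin.succ_lt_succ_iff.2 h)) (fun _ _ h => hb (Fin.succ_lt_succ_iff.2 h))
        rw [Matrix.det_succ_column_zero, Fin.sum_univ_succ, Finset.sum_eq_zero]
        · simp only [Matrix.of_apply, h0, if_true, Fin.val_zero, pow_zero, one_mul, add_zero]
          refine Eq.trans ?_ (hs.trans ?_)
          · rfl
          · refine if_congr ⟨?_, ?_⟩ rfl rfl
            · rintro ⟨h2, h3⟩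
              refine ⟨Fin.cases h0 h2, Fin.cases (fun h => ?_) fun i h => ?_⟩
              · exact h1 ⟨0, by simpa using h⟩
              · exact h3 i (by simpa using h)
            · rintro ⟨h2, h3⟩
              exact ⟨fun i => h2 i.succ, fun i h => h3 i.succ (by simpa using h)⟩
        · intro i _
          simp [h1 i]
    · rw [if_neg fun h => h0 (h.1 0)]
      refine Matrix.det_eq_zero_of_column_eq_zero 0 fun i => ?_
      have hi : a i ≤ a 0 := ha.antitone (Fin.zero_le i)
      simp only [Matrix.of_apply]
      rw [if_neg (by omega)]

/-- The strictly decreasing sequence `lᵢ - i` attached to a signature. -/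
theorem Sig.strictAnti_sub {n : ℕ} (l : Sig n) :
    StrictAnti fun i : Fin n => l.1 i - ((i : ℕ) : ℤ) := by
  intro i j h
  have h1 := l.2 i j h.le
  have h2 : (i : ℕ) < j := h
  dsimp only
  omega

theorem det_geometric_matrix {n : ℕ} {q : ℝ} (hq : 0 < q) (l m : Sig n) :
    Matrix.det (Matrix.of fun i j : Fin n =>
        if (l.1 j - ((j : ℕ) : ℤ)) - (m.1 i - ((i : ℕ) : ℤ)) ≤ 0
        then q ^ (-((l.1 j - ((j : ℕ) : ℤ)) - (m.1 i - ((i : ℕ) : ℤ)))) else 0)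
      = if Interlace l m then q ^ (∑ i : Fin n, (m.1 i - l.1 i)) else 0 := by
  set a : Fin n → ℤ := fun i => m.1 i - ((i : ℕ) : ℤ) with ha
  set b : Fin n → ℤ := fun i => l.1 i - ((i : ℕ) : ℤ) with hb
  have hstep := det_step_matrix n a b m.strictAnti_sub l.strictAnti_sub
  have hM : (Matrix.of fun i j : Fin n => if b j - a i ≤ 0 then q ^ (-(b j - a i)) else 0)
      = Matrix.of fun i j => q ^ (a i) *
          (Matrix.of fun i j => q ^ (-b j) *
            (Matrix.of fun i j => if b j ≤ a i then (1 : ℝ) else 0) i j) i j := by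
    ext i j
    simp only [Matrix.of_apply, sub_nonpos]
    split_ifs
    · rw [mul_one, ← zpow_add₀ hq.ne']
      congr 1
      ring
    · simp
  have hI : ((∀ i, b i ≤ a i) ∧ ∀ i : Fin n, ∀ h : (i : ℕ) + 1 < n, a ⟨(i : ℕ) + 1, h⟩ < b i)
      ↔ Interlace l m := by
    refine and_congr (forall_congr' fun i => ?_) (forall_congr' fun i => forall_congr' fun h => ?_)
    · simp [ha, hb]
    · simp only [ha, hb]
      push_cast
      omega
  refine (congrArg Matrix.det hM).trans ?_
  rw [Matrix.det_mul_column, Matrix.det_mul_row, hstep, if_congr hI rfl rfl]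
  split_ifs
  · have hprod (f : Fin n → ℤ) : ∏ i, q ^ f i = q ^ ∑ i, f i := by
      induction (Finset.univ : Finset (Fin n)) using Finset.induction_on with
      | empty => simp
      | insert i s hi ih => rw [Finset.prod_insert hi, Finset.sum_insert hi, ih, zpow_add₀ hq.ne']
    rw [mul_one, ← Finset.prod_mul_distrib, ← hprod]
    refine Finset.prod_congr rfl fun i _ => ?_
    rw [← zpow_add₀ hq.ne']
    congr 1
    simp only [ha, hb]
    ring
  · simp

/-- Determinantal evaluation for the geometric kernels: with
`f₋(m) = q^{-m} 1_{m ≤ 0}` and `f₊(m) = q^{m} 1_{m ≥ 0}`,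
`det[f₋((λⱼ−j)−(μᵢ−i))] = q^{Σ(μᵢ−λᵢ)} 1_{λ ≺ μ}` and
`det[f₊((λⱼ−j)−(μᵢ−i))] = q^{Σ(λᵢ−μᵢ)} 1_{μ ≺ λ}`. -/
theorem det_geometric_kernels
    (n : ℕ) (hn : 1 ≤ n) (q : ℝ) (hq0 : 0 < q) (hq1 : q < 1)
    (fminus fplus : ℤ → ℝ)
    (hfminus : ∀ m : ℤ, fminus m = if m ≤ 0 then q ^ (-m) else 0)
    (hfplus : ∀ m : ℤ, fplus m = if 0 ≤ m then q ^ m else 0) :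
    ∀ l m : Sig n,
      (Matrix.det (Matrix.of fun i j : Fin n =>
          fminus ((l.1 j - (j : ℕ)) - (m.1 i - (i : ℕ))))
        = if Interlace l m then q ^ (∑ i : Fin n, (m.1 i - l.1 i)) else 0) ∧
      (Matrix.det (Matrix.of fun i j : Fin n =>
          fplus ((l.1 j - (j : ℕ)) - (m.1 i - (i : ℕ))))
        = if Interlace m l then q ^ (∑ i : Fin n, (l.1 i - m.1 i)) else 0) := by
  intro l m
  refine ⟨?_, ?_⟩
  · simp only [hfminus]
    exact det_geometric_matrix hq0 l m
  · rw [← det_geometric_matrix hq0 m l, ← Matrix.det_transpose]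
    congr 1
    ext i j
    simp only [Matrix.transpose_apply, Matrix.of_apply, hfplus]
    refine if_congr (by omega) ?_ rfl
    congr 1
    ring
end

section
/- Let c be an LR family such that for all λ, τ ∈ 𝒲ₙ the set {μ : c(λ,μ,τ) ≠ 0} is finite. Let A be an annulus and θ ∈ ℂⁿ with nonzero, pairwise distinct coordinates, θⱼ^{−1} ∈ A for all j, and s_κ(θ) ≠ 0 for every κ ∈ 𝒲ₙ. Say that an analytic function F on A with F(θⱼ^{−1}) ≠ 0 for all j satisfies (Star) if for all λ, τ ∈ 𝒲ₙ: Σ_μ T_n(θ;F)(𝟎,μ)·c(λ,μ,τ)·s_τ(θ)/(s_λ(θ)·s_μ(θ)) = T_n(θ;F)(λ,τ), the sum running over the finitely many μ with c(λ,μ,τ) ≠ 0, and 𝟎 = (0,…,0). Suppose F₁ and F₂ satisfy (Star); suppose that for all κ, ρ ∈ 𝒲ₙ the series Σ_{ν∈𝒲ₙ} T_n(θ;F₁)(κ,ν)·T_n(θ;F₂)(ν,ρ) converges absolutely with sum T_n(θ;F₁F₂)(κ,ρ); and suppose that for all λ, τ ∈ 𝒲ₙ the triple series Σ_{σ,γ,ν∈𝒲ₙ}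 T_n(θ;F₁)(𝟎,σ)·c(λ,σ,γ)·(s_γ(θ)/(s_λ(θ)s_σ(θ)))·T_n(θ;F₂)(𝟎,ν)·c(γ,ν,τ)·(s_τ(θ)/(s_γ(θ)s_ν(θ))) converges absolutely. Then F₁·F₂ satisfies (Star). -/
open scoped BigOperators NNReal ENNReal

/-- The zero signature `𝟎 = (0,…,0)`. -/
def zeroSig (n : ℕ) : Sig n := ⟨fun _ => 0, fun _ _ _ => le_refl 0⟩

/-- The rational Schur function `s_λ(θ) = det[θᵢ^{λⱼ+n−j}] / det[θᵢ^{n−j}]`. -/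
noncomputable def schur {n : ℕ} (l : Sig n) (θ : Fin n → ℂ) : ℂ :=
  Matrix.det (Matrix.of fun i j : Fin n => θ i ^ (l.1 j + (n : ℤ) - 1 - (j : ℕ)))
    / Matrix.det (Matrix.of fun i j : Fin n => θ i ^ ((n : ℤ) - 1 - (j : ℕ)))

/-- The reduced determinantal kernel `D_f(κ,ν) = det[f((κ_j - j) - (ν_i - i))]`. -/
noncomputable def Dmat {n : ℕ} (f : ℤ → ℂ) (k v : Sig n) : ℂ :=
  Matrix.det (Matrix.of fun i j : Fin n => f ((k.1 j - (j : ℕ)) - (v.1 i - (i : ℕ))))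

/-- The `m`-th Laurent coefficient of `F`, computed on the circle `|z| = r`. -/
noncomputable def laurentCoeff (F : ℂ → ℂ) (r : ℝ) (m : ℤ) : ℂ :=
  (2 * Real.pi * Complex.I)⁻¹ • (∮ z in C(0, r), F z * z ^ (-m - 1))

/-- `T_n(θ;F)(κ,ν) = (s_ν(θ)/s_κ(θ))·D_f(κ,ν)/∏ⱼ F(θⱼ⁻¹)`, `f` the Laurent
coefficients of `F` on the circle `|z| = r`. -/
noncomputable def Tn {n : ℕ} (θ : Fin n → ℂ) (F : ℂ → ℂ) (r : ℝ) (k v : Sig n) : ℂ :=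
  schur v θ / schur k θ * Dmat (laurentCoeff F r) k v / ∏ j : Fin n, F (θ j)⁻¹

/-- An LR family: nonnegative structure constants for products of Schur functions. -/
def LRFamily (n : ℕ) (c : Sig n → Sig n → Sig n → ℕ) : Prop :=
  ∀ l m : Sig n, {t : Sig n | c l m t ≠ 0}.Finite ∧
    ∀ θ : Fin n → ℂ, (∀ j, θ j ≠ 0) → Function.Injective θ →
      schur l θ * schur m θ = ∑' t : Sig n, (c l m t : ℂ) * schur t θ

theorem schur_num_eq_zero_of_not_injective {n : ℕ} (e : Fin n → ℤ) {θ : Fin n → ℂ}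
    (hθ : ¬ Function.Injective θ) :
    Matrix.det (Matrix.of fun i j : Fin n => θ i ^ e j) = 0 := by
  simp only [Function.Injective, not_forall] at hθ
  obtain ⟨i, j, hij, hne⟩ := hθ
  exact Matrix.det_zero_of_row_eq hne (by ext k; simp [hij])

/-- The Laurent monomial `θ ↦ ∏ᵢ θᵢ ^ eᵢ`, as a character of the torus. -/
noncomputable def laurentMonomial {n : ℕ} (e : Fin n → ℤ) : (Fin n → ℂˣ) →* ℂ where
  toFun θ := ∏ i, (θ i : ℂ) ^ e i
  map_one' := by simp
  map_mul' θ η := by simp [mul_zpow, Finset.prod_mul_distrib]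

theorem laurentMonomial_injective (n : ℕ) :
    Function.Injective (laurentMonomial : (Fin n → ℤ) → (Fin n → ℂˣ) →* ℂ) := by
  intro e e' h
  ext i
  have h2 := DFunLike.congr_fun h
    (Function.update (1 : Fin n → ℂˣ) i (Units.mk0 2 two_ne_zero))
  have key (g : Fin n → ℤ) :
      laurentMonomial g (Function.update (1 : Fin n → ℂˣ) i (Units.mk0 2 two_ne_zero)) =
        (2 : ℂ) ^ g i := by
    change ∏ k, ((Function.update (1 : Fin n → ℂˣ) i (Units.mk0 2 two_ne_zero) k : ℂˣ) : ℂ) ^ g k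
      = _
    rw [Finset.prod_eq_single i]
    · simp
    · intro k _ hk
      simp [Function.update_of_ne hk]
    · simp
  rw [key, key] at h2
  have h3 : (2 : ℝ) ^ e i = (2 : ℝ) ^ e' i := by
    simpa only [norm_zpow, Complex.norm_ofNat] using congrArg norm h2
  exact zpow_right_injective₀ (by norm_num) (by norm_num) h3

/-- The strictly decreasing exponents `λⱼ + n - 1 - j`. -/
def Sig.exponent {n : ℕ} (l : Sig n) (j : Fin n) : ℤ := l.1 j + (n : ℤ) - 1 - (j : ℕ)

theorem Sig.exponent_strictAnti {n : ℕ} (l : Sig n) : StrictAnti l.exponent := by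
  intro i j hij
  have h1 := l.2 i j hij.le
  have h2 : (i : ℕ) < j := hij
  unfold Sig.exponent
  omega

theorem Sig.exponent_injective {n : ℕ} :
    Function.Injective (Sig.exponent : Sig n → Fin n → ℤ) := by
  intro l m h
  apply Subtype.ext
  ext i
  have := congrFun h i
  unfold Sig.exponent at this
  omega

theorem Sig.exponent_comp_perm_injective (n : ℕ) :
    Function.Injective fun p : Sig n × Equiv.Perm (Fin n) => p.1.exponent ∘ p.2 := by
  rintro ⟨l, s⟩ ⟨m, t⟩ h
  have h' : l.exponent ∘ s = m.exponent ∘ t := h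
  have hr : Set.range l.exponent = Set.range m.exponent := by
    rw [← s.surjective.range_comp l.exponent, h', t.surjective.range_comp]
  have hlm : l.exponent = m.exponent := by
    have := (StrictMono.range_inj (f := OrderDual.toDual ∘ l.exponent)
      (g := OrderDual.toDual ∘ m.exponent) (fun i j hij => l.exponent_strictAnti hij)
      (fun i j hij => m.exponent_strictAnti hij)).1 (by
        rw [Set.range_comp, Set.range_comp, hr])
    exact this
  have : l = m := Sig.exponent_injective hlm
  subst this
  refine Prod.ext rfl (Equiv.ext fun i => ?_)
  exact l.exponent_strictAnti.injective (congrFun h' i)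

/-- Schur functions are linearly independent as functions on the points with nonzero, pairwise
distinct coordinates. -/
theorem schur_linearIndependent {n : ℕ} (S : Finset (Sig n)) (d : Sig n → ℂ)
    (h : ∀ θ : Fin n → ℂ, (∀ j, θ j ≠ 0) → Function.Injective θ →
      ∑ t ∈ S, d t * schur t θ = 0) :
    ∀ t ∈ S, d t = 0 := by
  classical
  have hli : LinearIndependent ℂ (fun p : Sig n × Equiv.Perm (Fin n) =>
      (laurentMonomial (p.1.exponent ∘ p.2) : (Fin n → ℂˣ) → ℂ)) :=
    (linearIndependent_monoidHom (Fin n → ℂˣ) ℂ).comp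
      (fun p : Sig n × Equiv.Perm (Fin n) => laurentMonomial (p.1.exponent ∘ p.2))
      ((laurentMonomial_injective n).comp (Sig.exponent_comp_perm_injective n))
  have hnum (θ : Fin n → ℂˣ) :
      ∑ t ∈ S, d t * Matrix.det (Matrix.of fun i j : Fin n => (θ i : ℂ) ^ t.exponent j) = 0 := by
    by_cases hθ : Function.Injective fun i => (θ i : ℂ)
    · have h0 := h (fun i => (θ i : ℂ)) (fun j => (θ j).ne_zero) hθ
      simp only [schur, ← mul_div_assoc, ← Finset.sum_div] at h0
      refine (div_eq_zero_iff.1 h0).resolve_right ?_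
      have hV : (Matrix.of fun i j : Fin n => (θ i : ℂ) ^ ((n : ℤ) - 1 - (j : ℕ)))
          = (Matrix.vandermonde fun i => (θ i : ℂ)).submatrix id Fin.revPerm := by
        ext i j
        have : (n : ℤ) - 1 - (j : ℕ) = ((Fin.rev j : Fin n) : ℕ) := by
          rw [Fin.val_rev]; omega
        rw [Matrix.of_apply, this, zpow_natCast]
        simp only [Matrix.submatrix_apply, Matrix.vandermonde_apply, id, Fin.revPerm_apply]
      rw [hV, Matrix.det_permute']
      exact mul_ne_zero (by simp) (Matrix.det_vandermonde_ne_zero_iff.2 hθ)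
    · exact Finset.sum_eq_zero fun t _ => by
        rw [schur_num_eq_zero_of_not_injective t.exponent hθ, mul_zero]
  rw [linearIndependent_iff'] at hli
  intro t ht
  have := hli (S ×ˢ Finset.univ)
    (fun p => d p.1 * ((Equiv.Perm.sign p.2 : ℤ) : ℂ)) (by
      ext θ
      rw [Finset.sum_apply, Pi.zero_apply, Finset.sum_product, ← hnum θ]
      refine Finset.sum_congr rfl fun t _ => ?_
      rw [← Matrix.det_transpose, Matrix.det_apply', Finset.mul_sum]
      refine Finset.sum_congr rfl fun s _ => ?_
      simp [laurentMonomial, mul_assoc])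
    (t, 1) (by simp [ht])
  simpa using this

theorem LRFamily.schur_mul_schur {n : ℕ} {c : Sig n → Sig n → Sig n → ℕ} (hc : LRFamily n c)
    {l m : Sig n} {S : Finset (Sig n)} (hS : ∀ t, c l m t ≠ 0 → t ∈ S) {θ : Fin n → ℂ}
    (hθ0 : ∀ j, θ j ≠ 0) (hθ : Function.Injective θ) :
    schur l θ * schur m θ = ∑ t ∈ S, (c l m t : ℂ) * schur t θ := by
  rw [(hc l m).2 θ hθ0 hθ]
  refine tsum_eq_sum fun t ht => ?_
  have : c l m t = 0 := not_not.1 fun h0 => ht (hS t h0)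
  simp [this]

/-- Associativity of the structure constants. -/
theorem LRFamily.assoc {n : ℕ} {c : Sig n → Sig n → Sig n → ℕ} (hc : LRFamily n c)
    (l m k t : Sig n) :
    ∑' g, (c l m g : ℂ) * (c g k t : ℂ) = ∑' g, (c m k g : ℂ) * (c l g t : ℂ) := by
  classical
  let supp (a b : Sig n) : Finset (Sig n) := (hc a b).1.toFinset
  have mem_supp {a b u : Sig n} : u ∈ supp a b ↔ c a b u ≠ 0 := by simp [supp]
  rw [tsum_eq_sum (s := supp l m) (fun g hg => by simp [not_not.1 (mem_supp.not.1 hg)]),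
    tsum_eq_sum (s := supp m k) (fun g hg => by simp [not_not.1 (mem_supp.not.1 hg)])]
  let U : Finset (Sig n) := insert t
    (((supp l m).biUnion fun g => supp g k) ∪ ((supp m k).biUnion fun g => supp l g))
  rw [← sub_eq_zero]
  refine schur_linearIndependent U (fun u => ∑ g ∈ supp l m, (c l m g : ℂ) * (c g k u : ℂ) -
    ∑ g ∈ supp m k, (c m k g : ℂ) * (c l g u : ℂ)) (fun θ hθ0 hθ => ?_) t
    (Finset.mem_insert_self _ _)
  simp only [sub_mul, Finset.sum_sub_distrib, Finset.sum_mul]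
  rw [sub_eq_zero, Finset.sum_comm, Finset.sum_comm (s := U) (t := supp m k)]
  have h1 : schur l θ * schur m θ * schur k θ =
      ∑ g ∈ supp l m, ∑ u ∈ U, (c l m g : ℂ) * (c g k u : ℂ) * schur u θ := by
    rw [hc.schur_mul_schur (fun u => mem_supp.2) hθ0 hθ, Finset.sum_mul]
    refine Finset.sum_congr rfl fun g hg => ?_
    rw [mul_assoc, hc.schur_mul_schur (S := U) (fun u hu => Finset.mem_insert_of_mem
      (Finset.mem_union_left _ (Finset.mem_biUnion.2 ⟨g, hg, mem_supp.2 hu⟩))) hθ0 hθ,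
      Finset.mul_sum]
    simp only [mul_assoc]
  have h2 : schur l θ * (schur m θ * schur k θ) =
      ∑ g ∈ supp m k, ∑ u ∈ U, (c m k g : ℂ) * (c l g u : ℂ) * schur u θ := by
    rw [hc.schur_mul_schur (fun u => mem_supp.2) hθ0 hθ, Finset.mul_sum]
    refine Finset.sum_congr rfl fun g hg => ?_
    rw [mul_left_comm, hc.schur_mul_schur (S := U) (fun u hu => Finset.mem_insert_of_mem
      (Finset.mem_union_right _ (Finset.mem_biUnion.2 ⟨g, hg, mem_supp.2 hu⟩))) hθ0 hθ,
      Finset.mul_sum]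
    simp only [mul_assoc]
  rw [← h1, ← h2, mul_assoc]

/-- If two kernels are mixtures `∑ μ, P o μ * K l μ t` of kernels `K` obeying the associativity
relation, then so is their product. -/
theorem mixture_mul {α : Type*} (K : α → α → α → ℂ) (P Q R : α → α → ℂ) (o : α)
    (hK : ∀ l t, {m | K l m t ≠ 0}.Finite)
    (hassoc : ∀ l m k t, ∑' g, K l m g * K g k t = ∑' g, K m k g * K l g t)
    (hP : ∀ l t, ∑' m, P o m * K l m t = P l t)
    (hQ : ∀ l t, ∑' m, Q o m * K l m t = Q l t)
    (hsum : ∀ t, Summable fun v => P o v * Q v t)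
    (hR : ∀ l t, ∑' v, P l v * Q v t = R l t)
    (htriple : ∀ l t, Summable fun p : α × α × α =>
      (P o p.1 * K l p.1 p.2.1) * (Q o p.2.2 * K p.2.1 p.2.2 t)) (l t : α) :
    ∑' m, R o m * K l m t = R l t := by
  classical
  let S : Finset α := (hK l t).toFinset
  have hS (g : α) (hg : g ∉ S) : K l g t = 0 := by simpa [S] using hg
  let f (x g y : α) : ℂ := (P o x * K l x g) * (Q o y * K g y t)
  have hf : Summable fun p : α × α × α => f p.1 p.2.1 p.2.2 := htriple l t
  have hgx : Summable fun p : α × α => ∑' y, f p.1 p.2 y := by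
    have := (Equiv.prodAssoc α α α).summable_iff.2 hf
    exact this.prod
  have hfx (x : α) : Summable fun p : α × α => f x p.1 p.2 := hf.prod_factor x
  symm
  calc R l t = ∑' g, ∑' x, ∑' y, f x g y := by
        rw [← hR]
        refine tsum_congr fun g => ?_
        rw [← hP l g, ← hQ g t, ← tsum_mul_right]
        exact tsum_congr fun x => tsum_mul_left.symm
    _ = ∑' x, ∑' g, ∑' y, f x g y := hgx.tsum_comm
    _ = ∑' x, ∑' y, ∑' g, f x g y := tsum_congr fun x => (hfx x).tsum_comm.symm
    _ = ∑' x, ∑ g ∈ S, P o x * Q x g * K l g t := by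
        refine tsum_congr fun x => ?_
        have h1 (y : α) : ∑' g, f x g y = ∑ g ∈ S, P o x * (Q o y * K x y g) * K l g t := by
          calc ∑' g, f x g y = ∑' g, P o x * Q o y * (K l x g * K g y t) :=
                tsum_congr fun g => by ring
            _ = P o x * Q o y * ∑ g ∈ S, K x y g * K l g t := by
                rw [tsum_mul_left, hassoc, tsum_eq_sum (s := S) fun g hg => by simp [hS g hg]]
            _ = _ := by
                rw [Finset.mul_sum]
                exact Finset.sum_congr rfl fun g _ => by ring
        simp only [h1]
        rw [Summable.tsum_finsetSum fun g _ => ?_]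
        · refine Finset.sum_congr rfl fun g _ => ?_
          rw [tsum_mul_right, tsum_mul_left, hQ]
        · refine summable_of_hasFiniteSupport ((hK x g).subset fun y hy => ?_)
          intro h0
          exact hy (by simp [h0])
    _ = ∑ g ∈ S, R o g * K l g t := by
        rw [Summable.tsum_finsetSum fun g _ => (hsum g).mul_right _]
        exact Finset.sum_congr rfl fun g _ => by rw [tsum_mul_right, hR]
    _ = ∑' m, R o m * K l m t := (tsum_eq_sum fun g hg => by simp [hS g hg]).symm

/-- If `F₁, F₂` satisfy the identity (Star), and the relevant series converge absolutely,
then `F₁·F₂` satisfies (Star). -/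
theorem star_closed_under_multiplication
    (n : ℕ) (hn : 1 ≤ n)
    (c : Sig n → Sig n → Sig n → ℕ) (hc : LRFamily n c)
    (hcμ : ∀ l τ : Sig n, {μ : Sig n | c l μ τ ≠ 0}.Finite)
    (r₁ : ℝ≥0) (r₂ : ℝ≥0∞) (hr₁₂ : (r₁ : ℝ≥0∞) < r₂)
    (A : Set ℂ) (hA : A = {z : ℂ | r₁ < ‖z‖₊ ∧ (‖z‖₊ : ℝ≥0∞) < r₂})
    (θ : Fin n → ℂ) (hθ0 : ∀ j, θ j ≠ 0) (hθinj : Function.Injective θ)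
    (hθA : ∀ j, (θ j)⁻¹ ∈ A) (hs : ∀ κ : Sig n, schur κ θ ≠ 0)
    (r : ℝ) (hr : 0 < r) (hrA : Metric.sphere (0 : ℂ) r ⊆ A)
    (F₁ F₂ : ℂ → ℂ)
    (hF₁a : DifferentiableOn ℂ F₁ A) (hF₂a : DifferentiableOn ℂ F₂ A)
    (hF₁0 : ∀ j, F₁ (θ j)⁻¹ ≠ 0) (hF₂0 : ∀ j, F₂ (θ j)⁻¹ ≠ 0)
    -- `F₁` satisfies (Star):
    (hstar₁ : ∀ l τ : Sig n,
      ∑' μ : {μ : Sig n // c l μ τ ≠ 0},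
          Tn θ F₁ r (zeroSig n) μ.1 * (c l μ.1 τ : ℂ) * schur τ θ
            / (schur l θ * schur μ.1 θ)
        = Tn θ F₁ r l τ)
    -- `F₂` satisfies (Star):
    (hstar₂ : ∀ l τ : Sig n,
      ∑' μ : {μ : Sig n // c l μ τ ≠ 0},
          Tn θ F₂ r (zeroSig n) μ.1 * (c l μ.1 τ : ℂ) * schur τ θ
            / (schur l θ * schur μ.1 θ)
        = Tn θ F₂ r l τ)
    -- the semigroup property `T_n(θ;F₁)·T_n(θ;F₂) = T_n(θ;F₁F₂)` holds with absolute
    -- convergence: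
    (hsemi : ∀ κ ρ : Sig n,
      (Summable fun v : Sig n => ‖Tn θ F₁ r κ v * Tn θ F₂ r v ρ‖) ∧
      ∑' v : Sig n, Tn θ F₁ r κ v * Tn θ F₂ r v ρ
        = Tn θ (fun z => F₁ z * F₂ z) r κ ρ)
    -- the triple series converges absolutely:
    (htriple : ∀ l τ : Sig n,
      Summable fun p : Sig n × Sig n × Sig n =>
        ‖Tn θ F₁ r (zeroSig n) p.1 * (c l p.1 p.2.1 : ℂ) *
            (schur p.2.1 θ / (schur l θ * schur p.1 θ)) *
          (Tn θ F₂ r (zeroSig n) p.2.2 * (c p.2.1 p.2.2 τ : ℂ) *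
            (schur τ θ / (schur p.2.1 θ * schur p.2.2 θ)))‖) :
    -- then `F₁·F₂` satisfies (Star):
    ∀ l τ : Sig n,
      ∑' μ : {μ : Sig n // c l μ τ ≠ 0},
          Tn θ (fun z => F₁ z * F₂ z) r (zeroSig n) μ.1 * (c l μ.1 τ : ℂ) * schur τ θ
            / (schur l θ * schur μ.1 θ)
        = Tn θ (fun z => F₁ z * F₂ z) r l τ := by
  let K (l m t : Sig n) : ℂ := (c l m t : ℂ) * (schur t θ / (schur l θ * schur m θ))
  have hstar (F : ℂ → ℂ) (l τ : Sig n) :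
      ∑' μ : {μ : Sig n // c l μ τ ≠ 0},
          Tn θ F r (zeroSig n) μ.1 * (c l μ.1 τ : ℂ) * schur τ θ / (schur l θ * schur μ.1 θ)
        = ∑' μ, Tn θ F r (zeroSig n) μ * K l μ τ := by
    rw [← tsum_subtype_eq_of_support_subset (s := {μ | c l μ τ ≠ 0})]
    · refine tsum_congr fun μ => ?_
      simp only [K]
      ring
    · intro μ hμ h0
      exact hμ (by simp [K, h0])
  simp only [hstar] at hstar₁ hstar₂ ⊢
  refine mixture_mul K (Tn θ F₁ r) (Tn θ F₂ r) _ (zeroSig n) (fun l t => ?_) (fun l m k t => ?_)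
    hstar₁ hstar₂ (fun t => (hsemi _ t).1.of_norm) (fun κ ρ => (hsemi κ ρ).2) (fun l t => ?_)
  · refine (hcμ l t).subset fun m hm h0 => hm ?_
    simp [K, h0]
  · have h1 (g : Sig n) : K l m g * K g k t = (c l m g : ℂ) * (c g k t : ℂ) *
        (schur t θ / (schur l θ * schur m θ * schur k θ)) := by
      simp only [K]
      field_simp [hs]
    have h2 (g : Sig n) : K m k g * K l g t = (c m k g : ℂ) * (c l g t : ℂ) *
        (schur t θ / (schur l θ * schur m θ * schur k θ)) := by
      simp only [K]
      field_simp [hs]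
    simp only [h1, h2, tsum_mul_right, hc.assoc]
  · refine (htriple l t).of_norm.congr fun p => ?_
    simp only [K]
    ring
end

section
/- For all λ, μ ∈ 𝒲ₙ: Σ_{π ∈ Sₙ} sgn(π) · [∀ j ∈ {1,…,n}: λⱼ − j ≤ μ_{π(j)} − π(j)] equals 1 if λ ≺ μ, and equals 0 otherwise. Here [P] denotes 1 if the condition P holds and 0 otherwise, and Sₙ is the symmetric group on {1,…,n}. In particular, when λ ≺ μ the only permutation π for which the condition holds is the identity. -/
open scoped BigOperators

/-- The shifted entries `lⱼ - j` of a signature strictly decrease. -/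
lemma Sig.shifted_strictAnti {n : ℕ} (l : Sig n) :
    StrictAnti fun j : Fin n => l.1 j - ((j : ℕ) : ℤ) := by
  intro i j hij
  have h1 := l.2 i j hij.le
  have h2 : ((i : ℕ) : ℤ) < ((j : ℕ) : ℤ) := by exact_mod_cast hij
  show l.1 j - ((j : ℕ) : ℤ) < l.1 i - ((i : ℕ) : ℤ)
  linarith

/-- A permutation of `Fin n` that increases no element is the identity. -/
lemma perm_eq_one_of_apply_le {n : ℕ} (π : Equiv.Perm (Fin n)) (h : ∀ j, π j ≤ j) : π = 1 := by
  ext1 j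
  induction j using WellFoundedLT.induction with
  | ind j ih =>
    rcases (h j).lt_or_eq with hlt | heq
    · exact absurd (π.injective (ih _ hlt)) hlt.ne
    · exact heq

/-- If `b j < a j` for decreasing sequences `a`, `b`, then no rearrangement of `b` dominates `a`. -/
lemma not_forall_le_perm_of_lt {n : ℕ} {a b : Fin n → ℤ} (ha : StrictAnti a) (hb : StrictAnti b)
    {j : Fin n} (hj : b j < a j) (π : Equiv.Perm (Fin n)) : ¬ ∀ i, a i ≤ b (π i) := by
  intro h
  have hmaps : ∀ i ∈ Finset.Iic j, π i ∈ Finset.Iio j := by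
    intro i hi
    rw [Finset.mem_Iio]
    exact hb.lt_iff_gt.1 (hj.trans_le ((ha.antitone (Finset.mem_Iic.1 hi)).trans (h i)))
  have hcard := Finset.card_le_card_of_injOn π hmaps π.injective.injOn
  simp at hcard

/-- The signed count of permutations `π` with `a j ≤ b (π j)` is a determinant. -/
lemma sum_sign_mul_ite_eq_det {n : ℕ} (a b : Fin n → ℤ) :
    (∑ π : Equiv.Perm (Fin n), (Equiv.Perm.sign π : ℤ) *
      (if ∀ j : Fin n, a j ≤ b (π j) then 1 else 0)) =
    (Matrix.of fun i j : Fin n => if a j ≤ b i then (1 : ℤ) else 0).det := by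
  rw [Matrix.det_apply']
  refine Finset.sum_congr rfl fun π _ => ?_
  simp [Finset.prod_ite_zero]

/-- If `a i ≤ b (i + 1)` for some `i`, the signed count vanishes. -/
lemma sum_sign_mul_ite_eq_zero_of_superdiagonal {n : ℕ} {a b : Fin n → ℤ} (ha : StrictAnti a)
    (hb : StrictAnti b)
    (hsup : ∃ i : Fin n, ∃ h : (i : ℕ) + 1 < n, a i ≤ b ⟨(i : ℕ) + 1, h⟩) :
    (∑ π : Equiv.Perm (Fin n), (Equiv.Perm.sign π : ℤ) *
      (if ∀ j : Fin n, a j ≤ b (π j) then 1 else 0)) = 0 := by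
  obtain ⟨i, ⟨hi, hle⟩, hmax⟩ := (wellFounded_gt (α := Fin n)).has_min
    {i | ∃ h : (i : ℕ) + 1 < n, a i ≤ b ⟨(i : ℕ) + 1, h⟩} hsup
  set i' : Fin n := ⟨(i : ℕ) + 1, hi⟩ with hi'
  have hlt : i < i' := Fin.lt_def.2 (by simp [hi'])
  rw [sum_sign_mul_ite_eq_det]
  refine Matrix.det_zero_of_column_eq hlt.ne fun k => ?_
  have hiff : a i ≤ b k ↔ a i' ≤ b k := by
    refine ⟨(ha hlt).le.trans, fun hk => ?_⟩
    have hki : k ≤ i' := by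
      by_contra! hgt
      have hgt' : (i' : ℕ) < k := hgt
      have hn : (i' : ℕ) + 1 < n := by have := k.isLt; omega
      have hstep : (⟨(i' : ℕ) + 1, hn⟩ : Fin n) ≤ k := Fin.le_def.2 (by simpa using hgt')
      exact hmax i' ⟨hn, hk.trans (hb.antitone hstep)⟩ hlt
    exact hle.trans (hb.antitone hki)
  simp [hiff]

/-- ` Σ_{π∈Sₙ} sgn(π)·[∀j, λⱼ−j ≤ μ_{π(j)}−π(j)] = 1_{λ ≺ μ}`; moreover when `λ ≺ μ`
the only contributing permutation is the identity. -/
theorem signed_sum_interlace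
    (n : ℕ) (hn : 1 ≤ n) (l m : Sig n) :
    ((Interlace l m →
      (∑ π : Equiv.Perm (Fin n), (Equiv.Perm.sign π : ℤ) *
        (if ∀ j : Fin n, l.1 j - (j : ℕ) ≤ m.1 (π j) - ((π j : ℕ) : ℤ) then 1 else 0))
        = 1) ∧
    (¬ Interlace l m →
      (∑ π : Equiv.Perm (Fin n), (Equiv.Perm.sign π : ℤ) *
        (if ∀ j : Fin n, l.1 j - (j : ℕ) ≤ m.1 (π j) - ((π j : ℕ) : ℤ) then 1 else 0))
        = 0)) ∧
    (Interlace l m → ∀ π : Equiv.Perm (Fin n),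
      (∀ j : Fin n, l.1 j - (j : ℕ) ≤ m.1 (π j) - ((π j : ℕ) : ℤ)) → π = 1) := by
  have ha := l.shifted_strictAnti
  have hb := m.shifted_strictAnti
  have unique : Interlace l m → ∀ π : Equiv.Perm (Fin n),
      (∀ j : Fin n, l.1 j - (j : ℕ) ≤ m.1 (π j) - ((π j : ℕ) : ℤ)) → π = 1 := by
    intro h π hπ
    refine perm_eq_one_of_apply_le π fun j => ?_
    by_contra! hlt
    have hlt' : (j : ℕ) < π j := hlt
    have hj : (j : ℕ) + 1 < n := by have := (π j).isLt; omega
    have hle : (⟨(j : ℕ) + 1, hj⟩ : Fin n) ≤ π j := Fin.le_def.2 (by simpa using hlt')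
    have h1 := hb.antitone hle
    have h2 := h.2 j hj
    have h3 := hπ j
    push_cast at h1
    linarith
  refine ⟨⟨fun h => ?_, fun h => ?_⟩, unique⟩
  · rw [Finset.sum_eq_single 1]
    · have : ∀ j : Fin n, l.1 j - (j : ℕ) ≤ m.1 j - (j : ℕ) := fun j => by
        have := h.1 j
        linarith
      simpa using this
    · intro π _ hπ
      rw [if_neg fun hc => hπ (unique h π hc), mul_zero]
    · simp
  · by_cases hdiag : ∀ j : Fin n, l.1 j ≤ m.1 j
    · have hsup : ∃ i : Fin n, ∃ h : (i : ℕ) + 1 < n, l.1 i < m.1 ⟨(i : ℕ) + 1, h⟩ := by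
        by_contra! hc
        exact h ⟨hdiag, hc⟩
      refine sum_sign_mul_ite_eq_zero_of_superdiagonal ha hb ?_
      obtain ⟨i, hi, hlt⟩ := hsup
      refine ⟨i, hi, ?_⟩
      push_cast
      linarith
    · push Not at hdiag
      obtain ⟨j, hj⟩ := hdiag
      refine Finset.sum_eq_zero fun π _ => ?_
      rw [if_neg, mul_zero]
      exact not_forall_le_perm_of_lt ha hb (j := j) (by linarith) π
end

section
/- For all λ, μ ∈ 𝒲ₙ: Σ_{π ∈ Sₙ} sgn(π) · [∀ j ∈ {1,…,n}: (μ_{π(j)} − π(j)) − (λⱼ − j) ∈ {0,1}] equals 1 if μᵢ − λᵢ ∈ {0,1} for every i ∈ {1,…,n}, and equals 0 otherwise. Here [P] denotes 1 if the condition P holds and 0 otherwise, and Sₙ is the symmetric group on {1,…,n}. In particular, when all μᵢ − λᵢ ∈ {0,1}, the only permutation π for which the condition holds is the identity. -/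
open scoped BigOperators

/-- A permutation whose shifted entries all satisfy the `{0,1}` condition is increasing,
hence is the identity. -/
theorem Sig.perm_eq_one_of_shift {n : ℕ} (l m : Sig n) (π : Equiv.Perm (Fin n))
    (h : ∀ j : Fin n,
      (m.1 (π j) - ((π j : ℕ) : ℤ)) - (l.1 j - (j : ℕ)) = 0 ∨
      (m.1 (π j) - ((π j : ℕ) : ℤ)) - (l.1 j - (j : ℕ)) = 1) : π = 1 := by
  have hmono : StrictMono π := by
    intro j k hjk
    by_contra hlt
    have hne : π k ≠ π j := fun e => hjk.ne (π.injective e).symm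
    have hkj : π k < π j := lt_of_le_of_ne (not_lt.mp hlt) hne
    have hl := l.2 j k hjk.le
    have hm := m.2 (π k) (π j) hkj.le
    have hj := h j
    have hk := h k
    rw [Fin.lt_def] at hjk hkj
    omega
  exact Equiv.ext fun j => congrFun
    ((hmono.range_inj strictMono_id).1 (by simp [π.surjective.range_eq])) j

/-- `Σ_{π∈Sₙ} sgn(π)·[∀j, (μ_{π(j)}−π(j))−(λⱼ−j) ∈ {0,1}] = 1_{∀i, μᵢ−λᵢ∈{0,1}}`;
moreover when all `μᵢ−λᵢ ∈ {0,1}` the only contributing permutation is the identity. -/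
theorem signed_sum_bernoulli
    (n : ℕ) (hn : 1 ≤ n) (l m : Sig n) :
    (((∀ i : Fin n, m.1 i - l.1 i = 0 ∨ m.1 i - l.1 i = 1) →
      (∑ π : Equiv.Perm (Fin n), (Equiv.Perm.sign π : ℤ) *
        (if ∀ j : Fin n,
            (m.1 (π j) - ((π j : ℕ) : ℤ)) - (l.1 j - (j : ℕ)) = 0 ∨
            (m.1 (π j) - ((π j : ℕ) : ℤ)) - (l.1 j - (j : ℕ)) = 1
          then 1 else 0))
        = 1) ∧
    (¬ (∀ i : Fin n, m.1 i - l.1 i = 0 ∨ m.1 i - l.1 i = 1) →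
      (∑ π : Equiv.Perm (Fin n), (Equiv.Perm.sign π : ℤ) *
        (if ∀ j : Fin n,
            (m.1 (π j) - ((π j : ℕ) : ℤ)) - (l.1 j - (j : ℕ)) = 0 ∨
            (m.1 (π j) - ((π j : ℕ) : ℤ)) - (l.1 j - (j : ℕ)) = 1
          then 1 else 0))
        = 0)) ∧
    ((∀ i : Fin n, m.1 i - l.1 i = 0 ∨ m.1 i - l.1 i = 1) →
      ∀ π : Equiv.Perm (Fin n),
        (∀ j : Fin n,
          (m.1 (π j) - ((π j : ℕ) : ℤ)) - (l.1 j - (j : ℕ)) = 0 ∨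
          (m.1 (π j) - ((π j : ℕ) : ℤ)) - (l.1 j - (j : ℕ)) = 1) → π = 1) := by
  have hid : (∀ j : Fin n,
      (m.1 ((1 : Equiv.Perm (Fin n)) j) - (((1 : Equiv.Perm (Fin n)) j : ℕ) : ℤ)) -
        (l.1 j - (j : ℕ)) = 0 ∨
      (m.1 ((1 : Equiv.Perm (Fin n)) j) - (((1 : Equiv.Perm (Fin n)) j : ℕ) : ℤ)) -
        (l.1 j - (j : ℕ)) = 1) ↔ ∀ i : Fin n, m.1 i - l.1 i = 0 ∨ m.1 i - l.1 i = 1 := by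
    simp only [Equiv.Perm.one_apply, sub_sub_sub_cancel_right]
  refine ⟨⟨fun h => ?_, fun h => ?_⟩, fun _ π => Sig.perm_eq_one_of_shift l m π⟩
  · rw [Finset.sum_eq_single 1, if_pos (hid.2 h)]
    · simp
    · intro π _ hπ
      rw [if_neg (mt (Sig.perm_eq_one_of_shift l m π) hπ), mul_zero]
    · simp
  · refine Finset.sum_eq_zero fun π _ => ?_
    rw [if_neg, mul_zero]
    intro hπ
    obtain rfl := Sig.perm_eq_one_of_shift l m π hπ
    exact h (hid.1 hπ)
end
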